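/- For every integer n ≥ 6, there exist an integer d with d ≤ 4n − 6, matrices C₀, C₁, …, C_d each lying in the submonoid of 2^n × 2^n complex matrices generated by the Clifford gate embeddings H_i, S_i, S_i†, CNOT_{i,j}, and phase layers P₁, …, P_d on n qubits, such that the n-MCT matrix equals the product C₀ · P₁ · C₁ · P₂ · ⋯ · P_d · C_d; in particular the n-MCT gate admits an ancilla-free Clifford+Z_N realization with phase depth O(n). -/

import Mathlib

/-!
Gates are represented as matrices indexed by `Bool` (single qubit, so a 2×2 matrix)
or by `Fin n → Bool` (n qubits, so a 2^n × 2^n matrix). The basis index `true`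
corresponds to the basis state |1⟩ and `false` to |0⟩.
-/

namespace MCT

/-- The Hadamard gate `H = (1/√2)·[[1,1],[1,−1]]`. -/
noncomputable def Hg : Matrix Bool Bool ℂ :=
  fun a b => (1 / (Real.sqrt 2 : ℂ)) * (if a && b then -1 else 1)

/-- The phase gate `Z_N = diag(1, exp(iπ/N))`. -/
noncomputable def Zg (N : ℕ) : Matrix Bool Bool ℂ :=
  fun a b => if a = b then (if a then Complex.exp (Real.pi * Complex.I / N) else 1) else 0

/-- The adjoint phase gate `Z_N† = diag(1, exp(−iπ/N))`. -/
noncomputable def Zgd (N : ℕ) : Matrix Bool Bool ℂ :=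
  fun a b => if a = b then (if a then Complex.exp (-(Real.pi * Complex.I) / N) else 1) else 0

/-- Embedding `G_i = I₂^{⊗(i−1)} ⊗ G ⊗ I₂^{⊗(n−i)}` of a single-qubit gate `G`
on qubit `i` of `n` qubits. -/
noncomputable def embed {n : ℕ} (G : Matrix Bool Bool ℂ) (i : Fin n) :
    Matrix (Fin n → Bool) (Fin n → Bool) ℂ :=
  fun x y => (if ∀ j, j ≠ i → x j = y j then 1 else 0) * G (x i) (y i)

/-- `CNOT_{i,j}`: the permutation matrix mapping the basis state `y` to the state
with `y j` replaced by `y j ⊕ y i` (control `i`, target `j`). -/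
def cnot {n : ℕ} (i j : Fin n) : Matrix (Fin n → Bool) (Fin n → Bool) ℂ :=
  fun x y => if (∀ k, k ≠ j → x k = y k) ∧ x j = xor (y j) (y i) then 1 else 0

/-- The function on basis states realized by the `n`-MCT gate: the last bit is
XORed with the product (conjunction) of the first `n−1` bits. -/
def mctFun (n : ℕ) (y : Fin n → Bool) : Fin n → Bool :=
  fun k => if (k : ℕ) = n - 1 then
      xor (y k) (decide (∀ j : Fin n, (j : ℕ) < n - 1 → y j = true))
    else y k

/-- The `n`-MCT matrix: the permutation matrix mapping basis state
`|x₁…x_n⟩` to `|x₁…x_{n−1}, x_n ⊕ (x₁⋯x_{n−1})⟩`. -/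
def mct (n : ℕ) : Matrix (Fin n → Bool) (Fin n → Bool) ℂ :=
  fun x y => if x = mctFun n y then 1 else 0

/-- The Clifford generators on `n` qubits: the embeddings `H_i`, `S_i = (Z₂)_i`,
`S_i† = (Z₂†)_i`, and `CNOT_{i,j}` for `i ≠ j`. -/
def cliffordGens (n : ℕ) : Set (Matrix (Fin n → Bool) (Fin n → Bool) ℂ) :=
  {M | (∃ i, M = embed Hg i)
     ∨ (∃ i, M = embed (Zg 2) i)
     ∨ (∃ i, M = embed (Zgd 2) i)
     ∨ (∃ i j, i ≠ j ∧ M = cnot i j)}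

/-- The phase layer `D₁ ⊗ ⋯ ⊗ D_n` where `D_i = diag(1, e i)`. -/
def phaseLayer {n : ℕ} (e : Fin n → ℂ) : Matrix (Fin n → Bool) (Fin n → Bool) ℂ :=
  fun x y => if x = y then ∏ i, (if x i then e i else 1) else 0

/-- `z` is a valid phase-layer factor: `diag(1, z)` equals the identity, a `Z_{2^k}`
gate, or an adjoint thereof, i.e. `z = exp(iπ m / 2^k)` for some integers `m`, `k ≥ 0`. -/
def validFactor (z : ℂ) : Prop :=
  ∃ (m : ℤ) (k : ℕ), z = Complex.exp (Real.pi * Complex.I * m / 2 ^ k)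

open Matrix

section Layers

variable {n : ℕ}

/-- `LayerDepth d M` says that `M` is a product of Clifford circuits interleaved with exactly
`d` phase layers. -/
def LayerDepth : ℕ → Matrix (Fin n → Bool) (Fin n → Bool) ℂ → Prop
  | 0, M => M ∈ Submonoid.closure (cliffordGens n)
  | d + 1, M => ∃ C ∈ Submonoid.closure (cliffordGens n), ∃ e : Fin n → ℂ,
      (∀ i, validFactor (e i)) ∧ ∃ N, LayerDepth d N ∧ M = C * (phaseLayer e * N)

theorem LayerDepth.clifford_mul {d : ℕ} {C M : Matrix (Fin n → Bool) (Fin n → Bool) ℂ}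
    (hC : C ∈ Submonoid.closure (cliffordGens n)) (hM : LayerDepth d M) :
    LayerDepth d (C * M) := by
  cases d with
  | zero => exact Submonoid.mul_mem _ hC hM
  | succ d =>
    obtain ⟨C', hC', e, he, N, hN, rfl⟩ := hM
    exact ⟨C * C', Submonoid.mul_mem _ hC hC', e, he, N, hN, by rw [Matrix.mul_assoc]⟩

theorem LayerDepth.mul {a b : ℕ} {M N : Matrix (Fin n → Bool) (Fin n → Bool) ℂ}
    (hM : LayerDepth a M) (hN : LayerDepth b N) : LayerDepth (a + b) (M * N) := by
  induction a generalizing M with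
  | zero => rw [Nat.zero_add]; exact hN.clifford_mul hM
  | succ a ih =>
    obtain ⟨C, hC, e, he, M', hM', rfl⟩ := hM
    rw [Nat.add_right_comm]
    exact ⟨C, hC, e, he, M' * N, ih hM', by simp only [Matrix.mul_assoc]⟩

theorem LayerDepth.mul_clifford {d : ℕ} {C M : Matrix (Fin n → Bool) (Fin n → Bool) ℂ}
    (hM : LayerDepth d M) (hC : C ∈ Submonoid.closure (cliffordGens n)) :
    LayerDepth d (M * C) :=
  hM.mul (b := 0) hC

theorem layerDepth_phaseLayer {e : Fin n → ℂ} (he : ∀ i, validFactor (e i)) :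
    LayerDepth 1 (phaseLayer e) :=
  ⟨1, Submonoid.one_mem _, e, he, 1, Submonoid.one_mem _, by simp⟩

theorem LayerDepth.exists_eq_prod {d : ℕ} {M : Matrix (Fin n → Bool) (Fin n → Bool) ℂ}
    (hM : LayerDepth d M) :
    ∃ (C : Fin (d + 1) → Matrix (Fin n → Bool) (Fin n → Bool) ℂ) (e : Fin d → Fin n → ℂ),
      (∀ i, C i ∈ Submonoid.closure (cliffordGens n)) ∧ (∀ j i, validFactor (e j i)) ∧
      M = C 0 * (List.ofFn (fun j : Fin d => phaseLayer (e j) * C j.succ)).prod := by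
  induction d generalizing M with
  | zero => exact ⟨fun _ => M, Fin.elim0, fun _ => hM, fun j => j.elim0, by simp⟩
  | succ d ih =>
    obtain ⟨C, hC, e, he, N, hN, rfl⟩ := hM
    obtain ⟨C', e', hC', he', hN'⟩ := ih hN
    refine ⟨Fin.cons C C', Fin.cons e e', Fin.cases hC hC', Fin.cases he he', ?_⟩
    rw [List.ofFn_succ, List.prod_cons]
    simp [hN', Matrix.mul_assoc]

end Layers

section Gates

variable {n : ℕ}

/-- The permutation matrix mapping the basis state `y` to `f y`. -/
def permMat (f : (Fin n → Bool) → Fin n → Bool) : Matrix (Fin n → Bool) (Fin n → Bool) ℂ :=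
  fun x y => if x = f y then 1 else 0

theorem permMat_mul (f g : (Fin n → Bool) → Fin n → Bool) :
    permMat f * permMat g = permMat (f ∘ g) := by
  ext x y
  simp [permMat, Matrix.mul_apply]

theorem permMat_id : permMat (id : (Fin n → Bool) → Fin n → Bool) = 1 := by
  ext x y
  simp [permMat, Matrix.one_apply]

theorem permMat_conj_diagonal {f : (Fin n → Bool) → Fin n → Bool} (hf : Function.Involutive f)
    (g : (Fin n → Bool) → ℂ) :
    permMat f * (diagonal g * permMat f) = diagonal (g ∘ f) := by
  have h : permMat f * diagonal g = diagonal (g ∘ f) * permMat f := by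
    ext x y
    rw [Matrix.mul_diagonal, Matrix.diagonal_mul]
    by_cases hxy : x = f y
    · simp [permMat, hxy, hf y]
    · simp [permMat, hxy]
  rw [← Matrix.mul_assoc, h, Matrix.mul_assoc, permMat_mul, hf.comp_self, permMat_id,
    Matrix.mul_one]

theorem embed_mul_apply (A : Matrix Bool Bool ℂ) (i : Fin n)
    (M : Matrix (Fin n → Bool) (Fin n → Bool) ℂ) (x y : Fin n → Bool) :
    (embed A i * M) x y = ∑ b, A (x i) b * M (Function.update x i b) y := by
  rw [Matrix.mul_apply]
  symm
  refine Fintype.sum_of_injective (fun b => Function.update x i b)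
    (Function.update_injective x i) _ _ ?_ ?_
  · intro z hz
    have : ¬ ∀ j, j ≠ i → x j = z j := by
      intro h
      refine hz ⟨z i, ?_⟩
      ext j
      by_cases hj : j = i
      · subst hj; simp
      · simp [hj, h j hj]
    simp [embed, this]
  · intro b
    have : ∀ j, j ≠ i → x j = Function.update x i b j := fun j hj => by simp [hj]
    simp only [embed, if_pos this]
    simp

theorem embed_mul (A B : Matrix Bool Bool ℂ) (i : Fin n) :
    embed A i * embed B i = embed (A * B) i := by
  ext x y
  rw [embed_mul_apply]
  have : ∀ b, (∀ j, j ≠ i → Function.update x i b j = y j) ↔ ∀ j, j ≠ i → x j = y j := by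
    intro b
    refine forall₂_congr fun j hj => ?_
    simp [hj]
  simp only [embed, this, Matrix.mul_apply, Finset.mul_sum]
  refine Finset.sum_congr rfl fun b _ => ?_
  simp only [Function.update_self]
  ring

theorem embed_one (i : Fin n) : embed 1 i = 1 := by
  ext x y
  simp only [embed, Matrix.one_apply]
  by_cases h : x = y
  · simp [h]
  · by_cases h1 : x i = y i
    · have : ¬ ∀ j, j ≠ i → x j = y j := fun h2 =>
        h (funext fun j => if hj : j = i then hj ▸ h1 else h2 j hj)
      simp [h, this]
    · simp [h, h1]

theorem commute_embed_embed (A B : Matrix Bool Bool ℂ) {i j : Fin n} (hij : i ≠ j) :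
    Commute (embed A i) (embed B j) := by
  have key : ∀ (A B : Matrix Bool Bool ℂ) (i j : Fin n), i ≠ j → ∀ x y,
      (embed A i * embed B j) x y =
        (if ∀ k, k ≠ i → k ≠ j → x k = y k then 1 else 0) * (A (x i) (y i) * B (x j) (y j)) := by
    intro A B i j hij x y
    rw [embed_mul_apply, Finset.sum_eq_single (y i)]
    · have : (∀ k, k ≠ j → Function.update x i (y i) k = y k) ↔
          ∀ k, k ≠ i → k ≠ j → x k = y k := by
        refine forall_congr' fun k => ?_
        by_cases hk : k = i
        · subst hk; simp
        · simp [hk]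
      simp only [embed, this, Function.update_of_ne hij.symm]
      ring
    · intro b _ hb
      have : ¬ ∀ k, k ≠ j → Function.update x i b k = y k := fun h =>
        hb (by simpa using h i hij)
      simp [embed, this]
    · simp
  ext x y
  rw [key A B i j hij, key B A j i hij.symm]
  congr 1
  · congr 1
    exact propext ⟨fun h k h1 h2 => h k h2 h1, fun h k h1 h2 => h k h2 h1⟩
  · ring

theorem commute_diagonal_embed {g : (Fin n → Bool) → ℂ} {i : Fin n}
    (hg : ∀ x b, g (Function.update x i b) = g x) (A : Matrix Bool Bool ℂ) :
    Commute (diagonal g) (embed A i) := by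
  ext x y
  rw [Matrix.diagonal_mul, Matrix.mul_diagonal]
  by_cases h : ∀ j, j ≠ i → x j = y j
  · have : y = Function.update x i (y i) := by
      ext j
      by_cases hj : j = i
      · subst hj; simp
      · simp [hj, h j hj]
    rw [this, hg, mul_comm]
  · simp [embed, h]

/-- Negation of the `k`-th bit. -/
def flipBit (k : Fin n) (x : Fin n → Bool) : Fin n → Bool :=
  Function.update x k (!x k)

theorem flipBit_involutive (k : Fin n) : Function.Involutive (flipBit k) := by
  intro x
  simp [flipBit]

/-- The Pauli `X` matrix. -/
def pauliX : Matrix Bool Bool ℂ := fun a b => if a = !b then 1 else 0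

/-- The Pauli `Z` matrix. -/
def pauliZ : Matrix Bool Bool ℂ := diagonal fun a => if a then -1 else 1

theorem hadamard_mul_self : Hg * Hg = 1 := by
  have h : ((Real.sqrt 2 : ℝ) : ℂ) * (Real.sqrt 2 : ℝ) = 2 := by
    rw [← Complex.ofReal_mul, Real.mul_self_sqrt (by norm_num)]; simp
  have h' : ((Real.sqrt 2 : ℝ) : ℂ)⁻¹ * ((Real.sqrt 2 : ℝ) : ℂ)⁻¹ = 1 / 2 := by
    rw [← mul_inv, h]; norm_num
  ext a b
  cases a <;> cases b <;> simp [Hg, Matrix.mul_apply, h']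
  norm_num

theorem hadamard_mul_pauliZ_mul_hadamard : Hg * (pauliZ * Hg) = pauliX := by
  have h : ((Real.sqrt 2 : ℝ) : ℂ) * (Real.sqrt 2 : ℝ) = 2 := by
    rw [← Complex.ofReal_mul, Real.mul_self_sqrt (by norm_num)]; simp
  have h' : ((Real.sqrt 2 : ℝ) : ℂ)⁻¹ * ((Real.sqrt 2 : ℝ) : ℂ)⁻¹ = 1 / 2 := by
    rw [← mul_inv, h]; norm_num
  ext a b
  cases a <;> cases b <;> simp [Hg, pauliZ, pauliX, Matrix.mul_apply, h'] <;> norm_num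

theorem pauliZ_eq : pauliZ = Zg 2 * Zg 2 := by
  have h : Complex.exp (Real.pi * Complex.I / 2) * Complex.exp (Real.pi * Complex.I / 2) = -1 := by
    rw [← Complex.exp_add, add_halves, Complex.exp_pi_mul_I]
  ext a b
  cases a <;> cases b <;> simp [pauliZ, Zg, Matrix.mul_apply, h]

theorem embed_pauliX (k : Fin n) : embed pauliX k = permMat (flipBit k) := by
  ext x y
  simp only [embed, pauliX, permMat]
  have : x = flipBit k y ↔ (∀ j, j ≠ k → x j = y j) ∧ x k = !y k := by
    rw [flipBit, Function.eq_update_iff]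
    tauto
  simp only [this]
  by_cases h1 : ∀ j, j ≠ k → x j = y j <;> by_cases h2 : x k = !y k <;> simp [h1, h2]

theorem embed_hadamard_mem (k : Fin n) :
    embed Hg k ∈ Submonoid.closure (cliffordGens n) :=
  Submonoid.subset_closure (Or.inl ⟨k, rfl⟩)

theorem permMat_flipBit_mem (k : Fin n) :
    permMat (flipBit k) ∈ Submonoid.closure (cliffordGens n) := by
  have hS : embed (Zg 2) k ∈ Submonoid.closure (cliffordGens n) :=
    Submonoid.subset_closure (Or.inr (Or.inl ⟨k, rfl⟩))
  rw [← embed_pauliX, ← hadamard_mul_pauliZ_mul_hadamard, pauliZ_eq, ← embed_mul, ← embed_mul,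
    ← embed_mul]
  exact mul_mem (embed_hadamard_mem k) (mul_mem (mul_mem hS hS) (embed_hadamard_mem k))

/-- XOR of the bit `k` onto all bits in `s`. -/
def fanout (k : Fin n) (s : Finset (Fin n)) (x : Fin n → Bool) : Fin n → Bool :=
  fun j => if j ∈ s then xor (x j) (x k) else x j

theorem fanout_involutive {k : Fin n} {s : Finset (Fin n)} (hk : k ∉ s) :
    Function.Involutive (fanout k s) := by
  intro x
  ext j
  by_cases hj : j ∈ s <;> simp [fanout, hk, hj]

theorem permMat_fanout_mem {k : Fin n} {s : Finset (Fin n)} (hk : k ∉ s) :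
    permMat (fanout k s) ∈ Submonoid.closure (cliffordGens n) := by
  induction s using Finset.induction_on with
  | empty =>
    have : fanout k ∅ = id := by ext x j; simp [fanout]
    rw [this, permMat_id]
    exact one_mem _
  | insert a s ha ih =>
    have hka : k ≠ a := fun h => hk (by simp [h])
    have hks : k ∉ s := fun h => hk (by simp [h])
    have h : permMat (fanout k (insert a s)) = cnot k a * permMat (fanout k s) := by
      have h1 : cnot k a = permMat fun y : Fin n → Bool =>
          Function.update y a (xor (y a) (y k)) := by
        ext x y
        simp only [cnot, permMat]
        congr 1
        rw [Function.eq_update_iff, and_comm]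
      rw [h1, permMat_mul]
      congr 1
      ext x j
      by_cases hj : j = a
      · subst hj; simp [fanout, ha, hks]
      · simp [fanout, hj]
    rw [h]
    exact mul_mem (Submonoid.subset_closure (Or.inr (Or.inr (Or.inr ⟨k, a, hka, rfl⟩)))) (ih hks)

end Gates

section Phases

variable {n : ℕ}

/-- The diagonal entry of `phaseLayer e` at `x`. -/
def phaseVal (e : Fin n → ℂ) (x : Fin n → Bool) : ℂ := ∏ i, if x i then e i else 1

theorem phaseLayer_eq_diagonal (e : Fin n → ℂ) : phaseLayer e = diagonal (phaseVal e) := rfl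

theorem phaseVal_mul (e f : Fin n → ℂ) (x : Fin n → Bool) :
    phaseVal (e * f) x = phaseVal e x * phaseVal f x := by
  rw [phaseVal, phaseVal, phaseVal, ← Finset.prod_mul_distrib]
  refine Finset.prod_congr rfl fun i _ => ?_
  split_ifs <;> simp

theorem phaseVal_inv (e : Fin n → ℂ) (x : Fin n → Bool) :
    phaseVal e⁻¹ x = (phaseVal e x)⁻¹ := by
  rw [phaseVal, phaseVal, ← Finset.prod_inv_distrib]
  refine Finset.prod_congr rfl fun i _ => ?_
  split_ifs <;> simp

theorem phaseVal_update {e : Fin n → ℂ} {k : Fin n} (hk : e k = 1) (x : Fin n → Bool) (b : Bool) :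
    phaseVal e (Function.update x k b) = phaseVal e x := by
  refine Finset.prod_congr rfl fun i _ => ?_
  by_cases hi : i = k
  · subst hi; simp [hk]
  · simp [hi]

theorem validFactor_one : validFactor 1 := ⟨0, 0, by simp⟩

theorem validFactor.inv {z : ℂ} (hz : validFactor z) : validFactor z⁻¹ := by
  obtain ⟨m, k, rfl⟩ := hz
  refine ⟨-m, k, ?_⟩
  rw [← Complex.exp_neg]
  congr 1
  push_cast
  ring

theorem validFactor.mul {z w : ℂ} (hz : validFactor z) (hw : validFactor w) :
    validFactor (z * w) := by
  obtain ⟨m, k, rfl⟩ := hz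
  obtain ⟨m', k', rfl⟩ := hw
  refine ⟨m * 2 ^ k' + m' * 2 ^ k, k + k', ?_⟩
  rw [← Complex.exp_add]
  congr 1
  push_cast
  rw [pow_add]
  field_simp

theorem validFactor.ne_zero {z : ℂ} (hz : validFactor z) : z ≠ 0 := by
  obtain ⟨m, k, rfl⟩ := hz
  exact Complex.exp_ne_zero _

theorem validFactor_prod {ι : Type*} (s : Finset ι) {f : ι → ℂ} (hf : ∀ i ∈ s, validFactor (f i)) :
    validFactor (∏ i ∈ s, f i) :=
  Finset.prod_induction f validFactor (fun _ _ => validFactor.mul) validFactor_one hf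

theorem phaseVal_ne_zero {e : Fin n → ℂ} (he : ∀ i, validFactor (e i)) (x : Fin n → Bool) :
    phaseVal e x ≠ 0 := by
  refine Finset.prod_ne_zero_iff.2 fun i _ => ?_
  split_ifs
  · exact (he i).ne_zero
  · exact one_ne_zero

/-- The phase layer `e`, inverted when the bit `k` is set. -/
noncomputable def signedLayer (k : Fin n) (e : Fin n → ℂ) :
    Matrix (Fin n → Bool) (Fin n → Bool) ℂ :=
  diagonal fun x => if x k then (phaseVal e x)⁻¹ else phaseVal e x

theorem layerDepth_signedLayer {k : Fin n} {e : Fin n → ℂ} (he : ∀ i, validFactor (e i))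
    (hk : e k = 1) : LayerDepth 1 (signedLayer k e) := by
  set s : Finset (Fin n) := Finset.univ.erase k
  have hks : k ∉ s := by simp [s]
  set q : Fin n → ℂ := Function.update e k (∏ i, e i)⁻¹
  have hq : ∀ i, validFactor (q i) := by
    intro i
    by_cases hi : i = k
    · subst hi
      simpa [q] using validFactor.inv (validFactor_prod Finset.univ fun i _ => he i)
    · simpa [q, hi] using he i
  have h : signedLayer k e =
      permMat (fanout k s) * (phaseLayer q * permMat (fanout k s)) := by
    rw [phaseLayer_eq_diagonal, permMat_conj_diagonal (fanout_involutive hks), signedLayer]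
    congr 1
    funext x
    have hprod : ∀ z, phaseVal q z = (if z k then (∏ i, e i)⁻¹ else 1) * phaseVal e z := by
      intro z
      rw [phaseVal, phaseVal, ← Finset.mul_prod_erase _ _ (Finset.mem_univ k),
        ← Finset.mul_prod_erase (a := k) (s := Finset.univ) (fun i => if z i then e i else 1)
          (Finset.mem_univ k)]
      have : ∀ i ∈ Finset.univ.erase k, (if z i then q i else 1) = if z i then e i else 1 := by
        intro i hi
        simp [q, (Finset.mem_erase.1 hi).1]
      rw [Finset.prod_congr rfl this]
      simp [q, hk]
    rw [Function.comp_apply, hprod]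
    cases hx : x k
    · have : fanout k s x = x := by ext j; simp [fanout, hx]
      simp [this, hx]
    · have hne : ∏ i, e i ≠ 0 := Finset.prod_ne_zero_iff.2 fun i _ => (he i).ne_zero
      have hmul : phaseVal e (fanout k s x) * phaseVal e x = ∏ i, e i := by
        rw [phaseVal, phaseVal, ← Finset.prod_mul_distrib]
        refine Finset.prod_congr rfl fun i _ => ?_
        by_cases hi : i = k
        · subst hi; simp [hk]
        · cases hxi : x i <;> simp [fanout, s, hi, hx, hxi]
      have hz := phaseVal_ne_zero he x
      have hkk : fanout k s x k = true := by simp [fanout, hks, hx]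
      rw [hkk, if_pos rfl, if_pos rfl, ← hmul]
      rw [← hmul] at hne
      field_simp [left_ne_zero_of_mul hne]
  rw [h]
  exact ((layerDepth_phaseLayer hq).mul_clifford (permMat_fanout_mem hks)).clifford_mul
    (permMat_fanout_mem hks)

/-- The phase layer `e` controlled on the bit `k`. -/
noncomputable def controlledLayer (k : Fin n) (e : Fin n → ℂ) :
    Matrix (Fin n → Bool) (Fin n → Bool) ℂ :=
  diagonal fun x => if x k then phaseVal e x else 1

theorem controlledLayer_mul_self {e : Fin n → ℂ} (he : ∀ i, validFactor (e i)) (k : Fin n) :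
    controlledLayer k (e * e) = phaseLayer e * signedLayer k e⁻¹ := by
  rw [phaseLayer_eq_diagonal, controlledLayer, signedLayer, diagonal_mul_diagonal]
  congr 1
  funext x
  have := phaseVal_ne_zero he x
  cases x k <;> simp [phaseVal_inv, phaseVal_mul, this]

theorem controlledLayer_mul_inv {e : Fin n → ℂ} (he : ∀ i, validFactor (e i)) (k : Fin n) :
    controlledLayer k e * controlledLayer k e⁻¹ = 1 := by
  rw [controlledLayer, controlledLayer, diagonal_mul_diagonal, ← diagonal_one]
  congr 1
  funext x
  have := phaseVal_ne_zero he x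
  cases x k <;> simp [phaseVal_inv, this]

theorem signedLayer_mul_inv {e : Fin n → ℂ} (he : ∀ i, validFactor (e i)) (k : Fin n) :
    signedLayer k e * signedLayer k e⁻¹ = 1 := by
  rw [signedLayer, signedLayer, diagonal_mul_diagonal, ← diagonal_one]
  congr 1
  funext x
  have := phaseVal_ne_zero he x
  cases x k <;> simp [phaseVal_inv, this]

theorem layerDepth_controlledLayer {k : Fin n} {e : Fin n → ℂ} (he : ∀ i, validFactor (e i))
    (hk : e k = 1) : LayerDepth 2 (controlledLayer k (e * e)) := by
  rw [controlledLayer_mul_self he]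
  exact (layerDepth_phaseLayer he).mul (a := 1) (b := 1)
    (layerDepth_signedLayer (fun i => (he i).inv) (by simp [hk]))

theorem commute_signedLayer_embed {k i : Fin n} (hik : i ≠ k) {e : Fin n → ℂ} (hi : e i = 1)
    (A : Matrix Bool Bool ℂ) : Commute (signedLayer k e) (embed A i) := by
  refine commute_diagonal_embed (fun x b => ?_) A
  rw [phaseVal_update hi, Function.update_of_ne hik.symm]

/-- Conjugating `diag(1, -1)` on the qubit `k` together with a phase layer `e * e` on the others
by a signed layer and a Hadamard gate gives `X` on `k` after a controlled phase layer. -/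
theorem signedLayer_hadamard_conj {k : Fin n} {e : Fin n → ℂ} (he : ∀ i, validFactor (e i))
    (hk : e k = 1) :
    signedLayer k e * (embed Hg k * (phaseLayer (Function.update (e * e) k (-1)) *
      (embed Hg k * signedLayer k e⁻¹))) =
    permMat (flipBit k) * controlledLayer k (e * e * (e * e)) := by
  have hee : (e * e) k = 1 := by simp [hk]
  have h1 : phaseLayer (Function.update (e * e) k (-1)) = embed pauliZ k * phaseLayer (e * e) := by
    rw [phaseLayer_eq_diagonal, phaseLayer_eq_diagonal]
    have : embed pauliZ k = diagonal fun x : Fin n → Bool => if x k then (-1 : ℂ) else 1 := by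
      ext x y
      by_cases hxy : x = y
      · subst hxy; simp [embed, pauliZ]
      · by_cases hxk : x k = y k
        · have : ¬ ∀ j, j ≠ k → x j = y j := fun h2 =>
            hxy (funext fun j => if hj : j = k then hj ▸ hxk else h2 j hj)
          simp [embed, this, hxy]
        · simp [embed, pauliZ, hxy, hxk]
    rw [this, diagonal_mul_diagonal]
    congr 1
    funext x
    rw [phaseVal, phaseVal, ← Finset.mul_prod_erase _ _ (Finset.mem_univ k),
      ← Finset.mul_prod_erase (a := k) (s := Finset.univ)
        (fun i => if x i then (e * e) i else 1) (Finset.mem_univ k)]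
    have : ∀ i ∈ Finset.univ.erase k,
        (if x i then Function.update (e * e) k (-1) i else 1) = if x i then (e * e) i else 1 := by
      intro i hi
      rw [Function.update_of_ne (Finset.mem_erase.1 hi).1]
    rw [Finset.prod_congr rfl this]
    simp [hk]
  have h2 : phaseLayer (e * e) * embed Hg k = embed Hg k * phaseLayer (e * e) :=
    commute_diagonal_embed (phaseVal_update hee) Hg
  have h3 : embed Hg k * (embed pauliZ k * (phaseLayer (e * e) *
      (embed Hg k * signedLayer k e⁻¹))) =
      permMat (flipBit k) * (phaseLayer (e * e) * signedLayer k e⁻¹) := by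
    rw [← Matrix.mul_assoc (phaseLayer (e * e)), h2, ← embed_pauliX,
      ← hadamard_mul_pauliZ_mul_hadamard, ← embed_mul, ← embed_mul]
    simp only [Matrix.mul_assoc]
  rw [h1, Matrix.mul_assoc (embed pauliZ k), h3]
  have h4 : signedLayer k e * permMat (flipBit k) =
      permMat (flipBit k) * signedLayer k e⁻¹ := by
    ext x y
    rw [signedLayer, signedLayer, Matrix.diagonal_mul, Matrix.mul_diagonal]
    by_cases hxy : x = flipBit k y
    · subst hxy
      rw [flipBit, phaseVal_update hk, phaseVal_inv]
      cases hy : y k <;> simp [permMat, flipBit, hy]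
    · simp [permMat, hxy]
  rw [← Matrix.mul_assoc, h4, Matrix.mul_assoc]
  congr 1
  rw [phaseLayer_eq_diagonal, signedLayer, controlledLayer, diagonal_mul_diagonal,
    diagonal_mul_diagonal]
  congr 1
  funext x
  have := phaseVal_ne_zero he x
  cases x k
  · simp only [phaseVal_inv, phaseVal_mul, Bool.false_eq_true, if_false]
    field_simp
  · simp only [phaseVal_inv, phaseVal_mul, if_true, inv_inv]
    ring

/-- If conjugation by `G` turns the phase layer `e` into a permutation of basis states fixing the
bit `k`, then it turns the controlled phase layer into the controlled permutation. -/
theorem conj_controlledLayer {k : Fin n} {e : Fin n → ℂ}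
    {G G' : Matrix (Fin n → Bool) (Fin n → Bool) ℂ} {f : (Fin n → Bool) → Fin n → Bool}
    (hG : ∀ A, Commute G (embed A k)) (hGG' : G * G' = 1)
    (hf : G * (phaseLayer e * G') = permMat f) (hfk : ∀ x, f x k = x k) :
    G * (controlledLayer k e * G') = permMat fun x => if x k then f x else x := by
  have hproj : ∀ c : Bool, embed (diagonal fun a => if a = c then (1 : ℂ) else 0) k =
      diagonal fun x : Fin n → Bool => if x k = c then (1 : ℂ) else 0 := by
    intro c
    ext x y
    by_cases hxy : x = y
    · subst hxy; simp [embed]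
    · by_cases hxk : x k = y k
      · have : ¬ ∀ j, j ≠ k → x j = y j := fun h2 =>
          hxy (funext fun j => if hj : j = k then hj ▸ hxk else h2 j hj)
        simp [embed, this, hxy]
      · simp [embed, hxy, hxk]
  have hcom : ∀ c : Bool, G * diagonal (fun x : Fin n → Bool => if x k = c then (1 : ℂ) else 0) =
      diagonal (fun x : Fin n → Bool => if x k = c then (1 : ℂ) else 0) * G := by
    intro c
    rw [← hproj]
    exact hG _
  have hsplit : controlledLayer k e =
      diagonal (fun x : Fin n → Bool => if x k = false then (1 : ℂ) else 0) +
      diagonal (fun x : Fin n → Bool => if x k = true then (1 : ℂ) else 0) * phaseLayer e := by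
    rw [phaseLayer_eq_diagonal, diagonal_mul_diagonal, diagonal_add, controlledLayer]
    congr 1
    funext x
    cases x k <;> simp
  rw [hsplit, Matrix.add_mul, Matrix.mul_add, ← Matrix.mul_assoc, hcom, Matrix.mul_assoc, hGG',
    Matrix.mul_one, Matrix.mul_assoc, ← Matrix.mul_assoc G, hcom, Matrix.mul_assoc, hf]
  ext x y
  rw [Matrix.add_apply, Matrix.diagonal_mul, diagonal_apply]
  cases hy : y k
  · by_cases hxy : x = y
    · subst hxy
      simp [permMat, hy]
    · by_cases hxf : x = f y
      · have := hfk y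
        rw [← hxf] at this
        simp [permMat, hy, hxy, this]
      · simp [permMat, hy, hxy, hxf]
  · by_cases hxf : x = f y
    · have := hfk y
      rw [← hxf] at this
      rw [hy] at this
      simp [permMat, hy, hxf]
      simp [← hxf, this]
    · by_cases hxy : x = y
      · subst hxy
        simp [permMat, hy]
      · simp [permMat, hy, hxf, hxy]

end Phases

section Increment

variable {n : ℕ}

/-- Increment of the binary number stored, least significant bit first, in the bits `k, …, m - 1`,
modulo `2 ^ (m - k)`. -/
def increment (k m : ℕ) (x : Fin n → Bool) : Fin n → Bool :=
  fun j => if k ≤ (j : ℕ) ∧ (j : ℕ) < m then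
      xor (x j) (decide (∀ i : Fin n, k ≤ (i : ℕ) → i < j → x i = true))
    else x j

theorem increment_succ (k : Fin n) {m : ℕ} (hm : (k : ℕ) < m) :
    (increment k m : (Fin n → Bool) → Fin n → Bool) =
      flipBit k ∘ fun x => if x k then increment (k + 1) m x else x := by
  funext x j
  rw [Function.comp_apply]
  by_cases hj : j = k
  · subst hj
    have h1 : ∀ i : Fin n, (j : ℕ) ≤ i → i < j → x i = true := fun i h h' => by
      exact absurd h' (not_lt.2 h)
    have h2 : (j : ℕ) ≤ j ∧ (j : ℕ) < m := ⟨le_rfl, hm⟩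
    have h3 : increment (j + 1) m x j = x j := if_neg (by omega)
    rw [increment, if_pos h2, decide_eq_true h1]
    cases hx : x j <;> simp [flipBit, hx, h3]
  · have hj' : (j : ℕ) ≠ k := fun h => hj (Fin.ext h)
    simp only [flipBit, Function.update_of_ne hj]
    by_cases hkj : (k : ℕ) ≤ j ∧ (j : ℕ) < m
    · have hkj1 : (k : ℕ) + 1 ≤ j ∧ (j : ℕ) < m := ⟨by omega, hkj.2⟩
      cases hx : x k
      · have : ¬ ∀ i : Fin n, (k : ℕ) ≤ i → i < j → x i = true := fun h => by
          have := h k le_rfl (by rw [Fin.lt_def]; omega)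
          simp [hx] at this
        simp only [increment, if_pos hkj, decide_eq_false this, Bool.xor_false,
          Bool.false_eq_true, if_false]
      · have : (∀ i : Fin n, (k : ℕ) ≤ i → i < j → x i = true) ↔
            ∀ i : Fin n, (k : ℕ) + 1 ≤ i → i < j → x i = true := by
          refine ⟨fun h i h1 h2 => h i (by omega) h2, fun h i h1 h2 => ?_⟩
          by_cases hik : i = k
          · rw [hik, hx]
          · exact h i (by have : (i : ℕ) ≠ k := fun h => hik (Fin.ext h)
                          omega) h2
        simp only [increment, if_pos hkj, if_pos hkj1, this, if_true]
    · have hkj1 : ¬ ((k : ℕ) + 1 ≤ j ∧ (j : ℕ) < m) := by omega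
      cases hx : x k <;> simp only [increment, if_neg hkj, if_neg hkj1, if_true,
        Bool.false_eq_true, if_false]

/-- The phases `exp (iπ / 2 ^ (j - k + r))` on the qubits `k ≤ j < m`. -/
noncomputable def phaseGradient (n k m r : ℕ) : Fin n → ℂ :=
  fun j => if k ≤ (j : ℕ) ∧ (j : ℕ) < m then
    Complex.exp (Real.pi * Complex.I / 2 ^ ((j : ℕ) - k + r)) else 1

theorem validFactor_phaseGradient (k m r : ℕ) (j : Fin n) :
    validFactor (phaseGradient n k m r j) := by
  rw [phaseGradient]
  split_ifs
  · exact ⟨1, (j : ℕ) - k + r, by simp⟩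
  · exact validFactor_one

theorem phaseGradient_mul_self (k m r : ℕ) :
    phaseGradient n k m (r + 1) * phaseGradient n k m (r + 1) = phaseGradient n k m r := by
  funext j
  rw [Pi.mul_apply, phaseGradient, phaseGradient]
  split_ifs
  · rw [← Complex.exp_add, ← add_assoc, pow_succ]
    congr 1
    field_simp
    ring
  · simp

theorem phaseGradient_of_lt {k m r : ℕ} {j : Fin n} (hj : (j : ℕ) < k) :
    phaseGradient n k m r j = 1 :=
  if_neg (by omega)

theorem phaseGradient_zero (k : Fin n) {m : ℕ} (hm : (k : ℕ) < m) :
    phaseGradient n k m 0 = Function.update (phaseGradient n (k + 1) m 1) k (-1) := by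
  funext j
  by_cases hj : j = k
  · subst hj
    simp [phaseGradient, hm]
  · have hj' : (j : ℕ) ≠ k := fun h => hj (Fin.ext h)
    rw [Function.update_of_ne hj, phaseGradient, phaseGradient]
    by_cases h : (k : ℕ) ≤ j ∧ (j : ℕ) < m
    · rw [if_pos h, if_pos (by omega), show (j : ℕ) - k + 0 = j - (k + 1) + 1 by omega]
    · rw [if_neg h, if_neg (by omega)]

/-- If conjugation by `G` diagonalizes the increment of the bits above `k`, the increment of the
bits from `k` on is a conjugated controlled phase layer followed by `X` on `k`. -/
theorem flipBit_mul_conj_controlledLayer (k : Fin n) {m : ℕ} (hm : (k : ℕ) < m)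
    {G G' : Matrix (Fin n → Bool) (Fin n → Bool) ℂ}
    (hG : ∀ A, Commute G (embed A k)) (hGG' : G * G' = 1)
    (hinc : G * (phaseLayer (phaseGradient n (k + 1) m 0) * G') = permMat (increment (k + 1) m)) :
    permMat (flipBit k) * (G * (controlledLayer k (phaseGradient n (k + 1) m 0) * G')) =
      permMat (increment k m) := by
  rw [conj_controlledLayer hG hGG' hinc (fun x => if_neg (by omega)), permMat_mul,
    increment_succ k hm]

/-- The increment of the bits `k, …, m - 1` is diagonalized by a variant of the quantum Fourier
transform, with one phase layer for each bit but the last. -/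
theorem exists_diagonalizing_increment {m : ℕ} (hmn : m ≤ n) (t k : ℕ) (hk : k + t + 1 = m) :
    ∃ G G' : Matrix (Fin n → Bool) (Fin n → Bool) ℂ,
      LayerDepth t G ∧ LayerDepth t G' ∧ G * G' = 1 ∧
      (∀ i : Fin n, (i : ℕ) < k → ∀ A, Commute G (embed A i)) ∧
      G * (phaseLayer (phaseGradient n k m 0) * G') = permMat (increment k m) := by
  have hHH : ∀ i : Fin n, embed Hg i * embed Hg i = 1 := fun i => by
    rw [embed_mul, hadamard_mul_self, embed_one]
  induction t generalizing k with
  | zero =>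
    obtain ⟨i, rfl⟩ : ∃ i : Fin n, (i : ℕ) = k := ⟨⟨k, by omega⟩, rfl⟩
    have hgrad : ∀ r, phaseGradient n (i + 1) m r = 1 := fun r => by
      funext j
      exact if_neg (by omega)
    have hs : signedLayer i (1 : Fin n → ℂ) = 1 := by
      rw [signedLayer, ← diagonal_one]
      congr 1
      funext x
      simp [phaseVal]
    have hc : controlledLayer i (1 : Fin n → ℂ) = 1 := by
      rw [controlledLayer, ← diagonal_one]
      congr 1
      funext x
      simp [phaseVal]
    refine ⟨embed Hg i, embed Hg i, embed_hadamard_mem i, embed_hadamard_mem i, hHH i,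
      fun j hj A => commute_embed_embed _ _ fun h => by simp [h] at hj, ?_⟩
    have h := signedLayer_hadamard_conj (k := i) (e := 1) (fun _ => validFactor_one) rfl
    simp only [inv_one, hs, mul_one, one_mul, hc] at h
    rw [phaseGradient_zero i (by omega), hgrad, h, increment_succ i (by omega)]
    congr 1
    funext x j
    have : increment ((i : ℕ) + 1) m x = x := by
      funext j
      exact if_neg (by omega)
    simp [this]
  | succ t ih =>
    obtain ⟨i, rfl⟩ : ∃ i : Fin n, (i : ℕ) = k := ⟨⟨k, by omega⟩, rfl⟩
    obtain ⟨G, G', hG, hG', hGG', hcomm, hinc⟩ := ih (i + 1) (by omega)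
    set q := phaseGradient n (i + 1) m 2 with hq
    have hqv : ∀ j, validFactor (q j) := validFactor_phaseGradient _ _ _
    have hqi : q i = 1 := phaseGradient_of_lt (Nat.lt_succ_self _)
    refine ⟨G * (signedLayer i q * embed Hg i), embed Hg i * signedLayer i q⁻¹ * G',
      hG.mul ((layerDepth_signedLayer hqv hqi).mul_clifford (embed_hadamard_mem i)), ?_, ?_, ?_, ?_⟩
    · rw [Nat.add_comm t 1]
      exact ((layerDepth_signedLayer (fun j => (hqv j).inv) (by simp [hqi])).clifford_mul
        (embed_hadamard_mem i)).mul hG'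
    · calc G * (signedLayer i q * embed Hg i) * (embed Hg i * signedLayer i q⁻¹ * G')
          = G * (signedLayer i q * (embed Hg i * embed Hg i) * signedLayer i q⁻¹) * G' := by
            simp only [Matrix.mul_assoc]
        _ = 1 := by rw [hHH, Matrix.mul_one, signedLayer_mul_inv hqv, Matrix.mul_one, hGG']
    · intro j hj A
      have hji : j ≠ i := fun h => by simp [h] at hj
      exact (hcomm j (by omega) A).mul_left
        ((commute_signedLayer_embed hji (phaseGradient_of_lt (by omega)) A).mul_left
          (commute_embed_embed _ _ hji.symm))
    · have h := signedLayer_hadamard_conj hqv hqi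
      rw [hq, phaseGradient_mul_self, phaseGradient_mul_self, ← hq,
        ← phaseGradient_zero i (by omega)] at h
      have hX : G * permMat (flipBit i) = permMat (flipBit i) * G := by
        rw [← embed_pauliX]
        exact hcomm i (Nat.lt_succ_self _) _
      calc G * (signedLayer i q * embed Hg i) *
            (phaseLayer (phaseGradient n i m 0) * (embed Hg i * signedLayer i q⁻¹ * G'))
          = G * (signedLayer i q * (embed Hg i * (phaseLayer (phaseGradient n i m 0) *
              (embed Hg i * signedLayer i q⁻¹)))) * G' := by simp only [Matrix.mul_assoc]
        _ = permMat (flipBit i) *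
              (G * (controlledLayer i (phaseGradient n (i + 1) m 0) * G')) := by
            rw [h, ← Matrix.mul_assoc, hX]
            simp only [Matrix.mul_assoc]
        _ = permMat (increment i m) :=
            flipBit_mul_conj_controlledLayer i (by omega)
              (hcomm i (Nat.lt_succ_self _)) hGG' hinc

theorem layerDepth_increment {m : ℕ} (hmn : m ≤ n) (hm : 2 ≤ m) :
    LayerDepth (2 * m - 2) (permMat (increment 0 m : (Fin n → Bool) → Fin n → Bool)) ∧
    ∃ D : Matrix (Fin n → Bool) (Fin n → Bool) ℂ,
      LayerDepth (2 * m - 2) D ∧ D * permMat (increment 0 m) = 1 := by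
  obtain ⟨i, hi⟩ : ∃ i : Fin n, (i : ℕ) = 0 := ⟨⟨0, by omega⟩, rfl⟩
  obtain ⟨G, G', hG, hG', hGG', hcomm, hinc⟩ :=
    exists_diagonalizing_increment hmn (m - 2) (i + 1) (by omega)
  have hv : ∀ j, validFactor (phaseGradient n (i + 1) m 1 j) := validFactor_phaseGradient _ _ _
  have hv0 : ∀ j, validFactor (phaseGradient n (i + 1) m 0 j) := validFactor_phaseGradient _ _ _
  have h1 : phaseGradient n (i + 1) m 1 i = 1 := phaseGradient_of_lt (Nat.lt_succ_self _)
  have hdepth : 2 * m - 2 = (m - 2) + (2 + (m - 2)) := by omega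
  have hA := flipBit_mul_conj_controlledLayer i (by omega)
    (hcomm i (Nat.lt_succ_self _)) hGG' hinc
  rw [hi, zero_add] at hA
  rw [hi, zero_add] at hv h1 hv0
  have hC : LayerDepth 2 (controlledLayer i (phaseGradient n 1 m 0)) := by
    rw [← phaseGradient_mul_self]
    exact layerDepth_controlledLayer hv h1
  have hC' : LayerDepth 2 (controlledLayer i (phaseGradient n 1 m 0)⁻¹) := by
    rw [← phaseGradient_mul_self, mul_inv]
    exact layerDepth_controlledLayer (fun j => (hv j).inv) (by simp [h1])
  have hG'G : G' * G = 1 := mul_eq_one_comm.1 hGG'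
  refine ⟨?_, G * (controlledLayer i (phaseGradient n 1 m 0)⁻¹ * G') * permMat (flipBit i), ?_, ?_⟩
  · rw [← hA, hdepth]
    exact (hG.mul (hC.mul hG')).clifford_mul (permMat_flipBit_mem i)
  · rw [hdepth]
    exact (hG.mul (hC'.mul hG')).mul_clifford (permMat_flipBit_mem i)
  · have hXX : permMat (flipBit i) * permMat (flipBit i) = 1 := by
      rw [permMat_mul, (flipBit_involutive i).comp_self, permMat_id]
    rw [← hA]
    generalize hM : permMat (flipBit i) = X at hXX
    calc _ = G * (controlledLayer i (phaseGradient n 1 m 0)⁻¹ * (G' * ((X * X) * G) *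
            (controlledLayer i (phaseGradient n 1 m 0) * G'))) := by
          simp only [Matrix.mul_assoc]
      _ = G * ((controlledLayer i (phaseGradient n 1 m 0)⁻¹ *
            controlledLayer i (phaseGradient n 1 m 0)) * G') := by
          rw [hXX, Matrix.one_mul, hG'G, Matrix.one_mul, Matrix.mul_assoc]
      _ = 1 := by
          rw [mul_eq_one_comm.1 (controlledLayer_mul_inv hv0 i), Matrix.one_mul, hGG']

theorem increment_comp_mctFun (n : ℕ) :
    increment 0 (n - 1) ∘ mctFun n = (increment 0 n : (Fin n → Bool) → Fin n → Bool) := by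
  funext y j
  have hj := j.isLt
  by_cases hjn : (j : ℕ) = n - 1
  · have h1 : ¬ (0 ≤ (j : ℕ) ∧ (j : ℕ) < n - 1) := by omega
    have h2 : 0 ≤ (j : ℕ) ∧ (j : ℕ) < n := by omega
    have h3 : (∀ i : Fin n, (i : ℕ) < n - 1 → y i = true) ↔
        ∀ i : Fin n, 0 ≤ (i : ℕ) → i < j → y i = true := by
      refine forall_congr' fun i => ?_
      rw [Fin.lt_def, hjn]
      simp
    simp only [Function.comp_apply, increment, if_neg h1, if_pos h2, mctFun, if_pos hjn, h3]
  · have h1 : 0 ≤ (j : ℕ) ∧ (j : ℕ) < n - 1 := by omega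
    have h2 : 0 ≤ (j : ℕ) ∧ (j : ℕ) < n := by omega
    have h3 : ∀ i : Fin n, (i : ℕ) ≠ n - 1 → mctFun n y i = y i := fun i hi => if_neg hi
    have h4 : (∀ i : Fin n, 0 ≤ (i : ℕ) → i < j → mctFun n y i = true) ↔
        ∀ i : Fin n, 0 ≤ (i : ℕ) → i < j → y i = true := by
      refine forall_congr' fun i => forall₂_congr fun _ hi => ?_
      rw [h3 i (by rw [Fin.lt_def] at hi; omega)]
    simp only [Function.comp_apply, increment, if_pos h1, if_pos h2, h3 j hjn, h4]

end Increment

/-- For every `n ≥ 6`, the `n`-MCT gate admits an ancilla-free layered Clifford+`Z_N`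
realization `C₀ · P₁ · C₁ · P₂ ⋯ P_d · C_d` with phase depth `d ≤ 4n − 6 = O(n)`,
where each `C_i` lies in the submonoid generated by the Clifford gate embeddings
and each `P_j` is a phase layer. -/
theorem mct_cliffordZN_phase_depth :
    ∀ n : ℕ, 6 ≤ n → ∃ d : ℕ, (d : ℤ) ≤ 4 * (n : ℤ) - 6 ∧
      ∃ (C : Fin (d + 1) → Matrix (Fin n → Bool) (Fin n → Bool) ℂ)
        (e : Fin d → Fin n → ℂ),
        (∀ i, C i ∈ Submonoid.closure (cliffordGens n)) ∧
        (∀ j i, validFactor (e j i)) ∧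
        mct n = C 0 * (List.ofFn (fun j : Fin d => phaseLayer (e j) * C j.succ)).prod := by
  intro n hn
  obtain ⟨hinc, -⟩ := layerDepth_increment (le_refl n) (by omega)
  obtain ⟨-, D, hD, hDinc⟩ := layerDepth_increment (n := n) (m := n - 1) (by omega) (by omega)
  have hmct : mct n = D * permMat (increment 0 n) := by
    rw [← increment_comp_mctFun, ← permMat_mul, ← Matrix.mul_assoc, hDinc, Matrix.one_mul]
    rfl
  refine ⟨(2 * (n - 1) - 2) + (2 * n - 2), by omega, ?_⟩
  rw [hmct]
  exact (hD.mul hinc).exists_eq_prod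

end MCT
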